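/- Let h₁, h₂, h₃ : (0,t) → ℝ be measurable with h₁, h₂ ≥ 0 and |h₃| ≤ √(h₁h₂) a.e., and let K₁, K₂ ⊆ (0,t) be disjoint measurable sets with K = K₁ ∪ K₂. Then ∫_K h₁ · ∫_K h₂ − (∫_K h₃)² ≥ ( (∫_{K₁}h₁ · ∫_{K₂}h₂)^{1/2} − (∫_{K₂}h₁ · ∫_{K₁}h₂)^{1/2} )². -/

import Mathlib

open MeasureTheory Set

lemma cs_aux (μ : Measure ℝ) (f g h : ℝ → ℝ) (hf : Integrable f μ) (hg : Integrable g μ)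
    (hh : Integrable h μ)
    (hae : ∀ᵐ x ∂μ, 0 ≤ f x ∧ 0 ≤ g x ∧ |h x| ≤ Real.sqrt (f x * g x)) :
    0 ≤ ∫ x, f x ∂μ ∧ 0 ≤ ∫ x, g x ∂μ ∧
      |∫ x, h x ∂μ| ≤ Real.sqrt (∫ x, f x ∂μ) * Real.sqrt (∫ x, g x ∂μ) := by
  have h1 : 0 ≤ ∫ x, f x ∂μ := integral_nonneg_of_ae (hae.mono fun x hx => hx.1)
  have h2 : 0 ≤ ∫ x, g x ∂μ := integral_nonneg_of_ae (hae.mono fun x hx => hx.2.1)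
  refine ⟨h1, h2, ?_⟩
  rw [← Real.sqrt_mul h1]
  apply Real.abs_le_sqrt
  have key : ∀ s : ℝ, 0 ≤ (∫ x, f x ∂μ) * (s * s) + (2 * ∫ x, h x ∂μ) * s + ∫ x, g x ∂μ := by
    intro s
    have e : (∫ x, f x ∂μ) * (s * s) + (2 * ∫ x, h x ∂μ) * s + ∫ x, g x ∂μ
        = ∫ x, (f x * (s * s) + h x * (2 * s) + g x) ∂μ := by
      have hi : Integrable (fun x => f x * (s * s) + h x * (2 * s)) μ :=
        (hf.mul_const _).add (hh.mul_const _)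
      rw [integral_add hi hg,
        integral_add (hf.mul_const _) (hh.mul_const _), integral_mul_const, integral_mul_const]
      ring
    rw [e]
    refine integral_nonneg_of_ae (hae.mono fun x hx => ?_)
    obtain ⟨a, b, c⟩ := hx
    rw [Real.sqrt_mul a] at c
    have c1 : |h x * s| ≤ Real.sqrt (f x) * Real.sqrt (g x) * |s| := by
      rw [abs_mul]; gcongr
    have c2 := neg_abs_le (h x * s)
    have e1 := Real.sq_sqrt a
    have e2 := Real.sq_sqrt b
    have e3 := sq_abs s
    have e4 : f x * (s * s) = (Real.sqrt (f x) * |s|) ^ 2 := by rw [mul_pow, e1, e3]; ring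
    show 0 ≤ f x * (s * s) + h x * (2 * s) + g x
    rw [e4]
    nlinarith [sq_nonneg (Real.sqrt (f x) * |s| - Real.sqrt (g x))]
  have := discrim_le_zero key
  unfold discrim at this
  nlinarith

/-- Lower bound for `∫_K h₁ · ∫_K h₂ − (∫_K h₃)²` by a complete square, where
`K = K₁ ∪ K₂` with `K₁, K₂` disjoint. -/
theorem stmt5 (t : ℝ) (ht : 0 < t) (h₁ h₂ h₃ : ℝ → ℝ)
    (hi₁ : IntegrableOn h₁ (Ioo 0 t)) (hi₂ : IntegrableOn h₂ (Ioo 0 t))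
    (hi₃ : IntegrableOn h₃ (Ioo 0 t))
    (hae : ∀ᵐ x ∂(volume.restrict (Ioo 0 t)),
      0 ≤ h₁ x ∧ 0 ≤ h₂ x ∧ |h₃ x| ≤ Real.sqrt (h₁ x * h₂ x))
    (K₁ K₂ : Set ℝ) (hK₁ : MeasurableSet K₁) (hK₂ : MeasurableSet K₂)
    (hsub₁ : K₁ ⊆ Ioo 0 t) (hsub₂ : K₂ ⊆ Ioo 0 t) (hdisj : Disjoint K₁ K₂) :
    (Real.sqrt ((∫ x in K₁, h₁ x) * (∫ x in K₂, h₂ x)) -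
        Real.sqrt ((∫ x in K₂, h₁ x) * (∫ x in K₁, h₂ x))) ^ 2 ≤
      (∫ x in K₁ ∪ K₂, h₁ x) * (∫ x in K₁ ∪ K₂, h₂ x) -
        (∫ x in K₁ ∪ K₂, h₃ x) ^ 2 := by
  obtain ⟨a1, b1, c1⟩ := cs_aux (volume.restrict K₁) h₁ h₂ h₃ (hi₁.mono_set hsub₁)
    (hi₂.mono_set hsub₁) (hi₃.mono_set hsub₁) (ae_restrict_of_ae_restrict_of_subset hsub₁ hae)
  obtain ⟨a2, b2, c2⟩ := cs_aux (volume.restrict K₂) h₁ h₂ h₃ (hi₁.mono_set hsub₂)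
    (hi₂.mono_set hsub₂) (hi₃.mono_set hsub₂) (ae_restrict_of_ae_restrict_of_subset hsub₂ hae)
  rw [setIntegral_union hdisj hK₂ (hi₁.mono_set hsub₁) (hi₁.mono_set hsub₂),
    setIntegral_union hdisj hK₂ (hi₂.mono_set hsub₁) (hi₂.mono_set hsub₂),
    setIntegral_union hdisj hK₂ (hi₃.mono_set hsub₁) (hi₃.mono_set hsub₂),
    Real.sqrt_mul a1, Real.sqrt_mul a2]
  generalize (∫ x in K₁, h₁ x) = A1 at *
  generalize (∫ x in K₂, h₁ x) = A2 at *
  generalize (∫ x in K₁, h₂ x) = B1 at *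
  generalize (∫ x in K₂, h₂ x) = B2 at *
  generalize (∫ x in K₁, h₃ x) = C1 at *
  generalize (∫ x in K₂, h₃ x) = C2 at *
  have q : (C1 + C2) ^ 2 ≤ (√A1 * √B1 + √A2 * √B2) ^ 2 :=
    sq_le_sq' (by linarith [neg_abs_le C1, neg_abs_le C2])
      (by linarith [le_abs_self C1, le_abs_self C2])
  have r : (A1 + A2) * (B1 + B2) = (√A1 ^ 2 + √A2 ^ 2) * (√B1 ^ 2 + √B2 ^ 2) := by
    rw [Real.sq_sqrt a1, Real.sq_sqrt a2, Real.sq_sqrt b1, Real.sq_sqrt b2]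
  rw [r]
  linarith
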